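/- Let m ≥ 1, n ≥ 1, 1 ≤ k ≤ n, n⃗ ∈ I_{k,n}, 1 ≤ j ≤ k, and k⃗ = (k_1,…,k_j) ∈ I_{j,k}. Define p⃗ = (p_1,…,p_j) ∈ I_{j,n} by p_t = Σ_{k⃗^t < s ≤ k⃗^{t+1}} n_s. Then for every ordered pair (i,i′) with 1 ≤ i < i′ ≤ mn, ρ^{(m)}_{j,k⃗}(ρ^{(m)}_{k,n⃗}(i,i′)) = ρ^{(m)}_{j,p⃗}(i,i′). (This is the associativity of the right action of the associative operad on the divided powers γ_m𝓑 of the choose-two operad.) -/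

import Mathlib

noncomputable section

/-- Partial sum `n⃗^s = n₁ + ⋯ + n_{s−1}` (so `psum nv 1 = 0`). -/
def psum (nv : ℕ → ℕ) (s : ℕ) : ℕ := ∑ i ∈ Finset.Ico 1 s, nv i

/-- The block of `a` with respect to the tuple `nv`: the unique `s ≥ 1` with
`n⃗^s < a ≤ n⃗^{s+1}`, realized as the least `s ≥ 1` with `a ≤ n⃗^{s+1}`. -/
def blk (nv : ℕ → ℕ) (a : ℕ) : ℕ := sInf {s : ℕ | 1 ≤ s ∧ a ≤ psum nv (s + 1)}

/-- The column `a_i ∈ {1,…,n}` of `i ∈ {1,…,mn}`, i.e. the unique `a` with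
`i = (a−1)m + r`, `1 ≤ r ≤ m`. -/
def col (m i : ℕ) : ℕ := (i - 1) / m + 1

/-- The row `r_i ∈ {1,…,m}` of `i ∈ {1,…,mn}`. -/
def row (m i : ℕ) : ℕ := (i - 1) % m + 1

/-- `ι_r(i) = (i−1)m + r`. -/
def iot (m r i : ℕ) : ℕ := (i - 1) * m + r

/-- The right-action map `ρ^{(m)}_{k,n⃗}` on ordered pairs, with basepoint `+ = none`:
`ρ^{(m)}_{k,n⃗}(i,j) = ((s−1)m+r, (t−1)m+r)` if the block `s` of `a_i` is strictly smaller
than the block `t` of `a_j` and `r_i = r_j = r`; otherwise `+`. -/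
def rho (m : ℕ) (nv : ℕ → ℕ) (ij : ℕ × ℕ) : Option (ℕ × ℕ) :=
  if blk nv (col m ij.1) < blk nv (col m ij.2) ∧ row m ij.1 = row m ij.2 then
    some ((blk nv (col m ij.1) - 1) * m + row m ij.1,
          (blk nv (col m ij.2) - 1) * m + row m ij.1)
  else none

/-- The `s`-th component `λ^{(m)}_{k,n⃗,s}` of the left-action map, with basepoint `+ = none`:
`λ^{(m)}_{k,n⃗,s}(i,j) = ((a_i − n⃗^s − 1)m + r, (a_j − n⃗^s − 1)m + r)` if
`n⃗^s < a_i < a_j ≤ n⃗^{s+1}` and `r_i = r_j = r`; otherwise `+`. -/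
def lam (m : ℕ) (nv : ℕ → ℕ) (s : ℕ) (ij : ℕ × ℕ) : Option (ℕ × ℕ) :=
  if psum nv s < col m ij.1 ∧ col m ij.1 < col m ij.2 ∧ col m ij.2 ≤ psum nv (s + 1)
      ∧ row m ij.1 = row m ij.2 then
    some ((col m ij.1 - psum nv s - 1) * m + row m ij.1,
          (col m ij.2 - psum nv s - 1) * m + row m ij.1)
  else none

end

theorem psum_mono (nv : ℕ → ℕ) : Monotone (psum nv) := fun _ _ h =>
  Finset.sum_le_sum_of_subset (Finset.Ico_subset_Ico_right h)

theorem psum_one (nv : ℕ → ℕ) : psum nv 1 = 0 := by simp [psum]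

theorem psum_add_sum_Ioc (nv : ℕ → ℕ) {a b : ℕ} (h : a ≤ b) :
    psum nv (a + 1) + ∑ s ∈ Finset.Ioc a b, nv s = psum nv (b + 1) := by
  have hI : Finset.Ioc a b = Finset.Ico (a + 1) (b + 1) := by
    ext x
    simp only [Finset.mem_Ioc, Finset.mem_Ico]
    omega
  rw [hI]
  exact Finset.sum_Ico_consecutive nv (by omega) (by omega)

/-- Partial sums of the merged tuple `p⃗` are partial sums of `n⃗`. -/
theorem psum_merge {nv kv pv : ℕ → ℕ}
    (hpv : ∀ t, pv t = ∑ s ∈ Finset.Ioc (psum kv t) (psum kv (t + 1)), nv s) (b : ℕ) :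
    psum pv (b + 1) = psum nv (psum kv (b + 1) + 1) := by
  induction b with
  | zero => simp [psum_one]
  | succ b ih =>
    rw [← psum_add_sum_Ioc nv (psum_mono kv (Nat.le_succ (b + 1))), ← ih, ← hpv]
    exact Finset.sum_Ico_succ_top (by omega) pv

section Block

variable {nv : ℕ → ℕ} {k a : ℕ}

theorem blk_mem (hk : 1 ≤ k) (ha : a ≤ psum nv (k + 1)) :
    1 ≤ blk nv a ∧ a ≤ psum nv (blk nv a + 1) :=
  Nat.sInf_mem (s := {s : ℕ | 1 ≤ s ∧ a ≤ psum nv (s + 1)}) ⟨k, hk, ha⟩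

theorem blk_le {b : ℕ} (hb : 1 ≤ b) (ha : a ≤ psum nv (b + 1)) : blk nv a ≤ b :=
  Nat.sInf_le ⟨hb, ha⟩

theorem blk_le_blk {a' : ℕ} (hk : 1 ≤ k) (ha' : a' ≤ psum nv (k + 1)) (h : a ≤ a') :
    blk nv a ≤ blk nv a' :=
  blk_le (blk_mem hk ha').1 (h.trans (blk_mem hk ha').2)

theorem blk_le_iff (hk : 1 ≤ k) (ha1 : 1 ≤ a) (ha : a ≤ psum nv (k + 1)) (b : ℕ) :
    blk nv a ≤ b ↔ a ≤ psum nv (b + 1) := by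
  obtain ⟨h1, h2⟩ := blk_mem hk ha
  refine ⟨fun h => h2.trans (psum_mono nv (by omega)), fun h => blk_le ?_ h⟩
  by_contra hb
  obtain rfl : b = 0 := by omega
  rw [psum_one] at h
  omega

/-- Taking blocks with respect to `n⃗` and then `k⃗` is taking blocks with respect to `p⃗`. -/
theorem blk_blk {kv pv : ℕ → ℕ} (hk : 1 ≤ k) (ha1 : 1 ≤ a) (ha : a ≤ psum nv (k + 1))
    (hpv : ∀ t, pv t = ∑ s ∈ Finset.Ioc (psum kv t) (psum kv (t + 1)), nv s) :
    blk kv (blk nv a) = blk pv a := by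
  rw [blk, blk.eq_1 pv]
  simp only [blk_le_iff hk ha1 ha, psum_merge hpv]

end Block

theorem one_le_row (m i : ℕ) : 1 ≤ row m i := Nat.le_add_left 1 _

theorem row_le {m : ℕ} (hm : 1 ≤ m) (i : ℕ) : row m i ≤ m := Nat.mod_lt (i - 1) hm

theorem col_mul_add {m s r : ℕ} (hs : 1 ≤ s) (hr1 : 1 ≤ r) (hr : r ≤ m) :
    col m ((s - 1) * m + r) = s := by
  rw [col, Nat.add_sub_assoc hr1, Nat.add_comm (_ * m), Nat.add_mul_div_right _ _ (by omega),
    Nat.div_eq_of_lt (by omega)]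
  omega

theorem row_mul_add {m s r : ℕ} (hr1 : 1 ≤ r) (hr : r ≤ m) :
    row m ((s - 1) * m + r) = r := by
  rw [row, Nat.add_sub_assoc hr1, Nat.add_comm (_ * m), Nat.add_mul_mod_self_right,
    Nat.mod_eq_of_lt (by omega)]
  omega

theorem one_le_col (m i : ℕ) : 1 ≤ col m i := Nat.le_add_left 1 _

theorem col_mono (m : ℕ) : Monotone (col m) := fun _ _ h =>
  Nat.add_le_add_right (Nat.div_le_div_right (Nat.sub_le_sub_right h 1)) 1

theorem col_le {m n i : ℕ} (hi1 : 1 ≤ i) (hi : i ≤ m * n) : col m i ≤ n :=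
  Nat.div_lt_of_lt_mul (by omega)

/-- associativity of the right action of the associative operad on the
divided powers `γ_m𝓑` of the choose-two operad:
`ρ^{(m)}_{j,k⃗} ∘ ρ^{(m)}_{k,n⃗} = ρ^{(m)}_{j,p⃗}` where `p_t = Σ_{k⃗^t < s ≤ k⃗^{t+1}} n_s`. -/
theorem stmt2 (m n k j : ℕ) (hm : 1 ≤ m) (hn : 1 ≤ n)
    (hk1 : 1 ≤ k) (hkn : k ≤ n)
    (nv : ℕ → ℕ) (hnv : ∑ s ∈ Finset.Icc 1 k, nv s = n)
    (hj1 : 1 ≤ j) (hjk : j ≤ k)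
    (kv : ℕ → ℕ) (hkv : ∑ t ∈ Finset.Icc 1 j, kv t = k)
    (pv : ℕ → ℕ)
    (hpv : ∀ t, pv t = ∑ s ∈ Finset.Ioc (psum kv t) (psum kv (t + 1)), nv s) :
    ∀ i i' : ℕ, 1 ≤ i → i < i' → i' ≤ m * n →
      Option.bind (rho m nv (i, i')) (fun p => rho m kv p) = rho m pv (i, i') := by
  intro i i' hi hii' hi'
  have hn' : psum nv (k + 1) = n := hnv
  have hc' : col m i' ≤ psum nv (k + 1) := hn' ▸ col_le (by omega) hi'
  have hcc : col m i ≤ col m i' := col_mono m hii'.le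
  have hc : col m i ≤ psum nv (k + 1) := hcc.trans hc'
  have hb := blk_blk hk1 (one_le_col m i) hc hpv
  have hb' := blk_blk hk1 (one_le_col m i') hc' hpv
  have hle := blk_le_blk hk1 hc' hcc
  by_cases h : blk nv (col m i) < blk nv (col m i') ∧ row m i = row m i'
  · have hr1 := one_le_row m i
    have hr := row_le hm i
    rw [rho, if_pos h, Option.bind_some]
    simp only [rho, col_mul_add (blk_mem hk1 hc).1 hr1 hr,
      col_mul_add (blk_mem hk1 hc').1 hr1 hr, row_mul_add hr1 hr, hb, hb', ← h.2]
  · rw [rho, if_neg h, Option.bind_none, rho, if_neg]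
    rintro ⟨hlt, hrow⟩
    have heq : blk nv (col m i) = blk nv (col m i') :=
      hle.antisymm (not_lt.mp fun hlt' => h ⟨hlt', hrow⟩)
    rw [← hb, ← hb', heq] at hlt
    exact lt_irrefl _ hlt
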